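/- Let ν > 0, x₀ ∈ ℝ³, t₀ ∈ ℝ, a > 0, ρ > 0, θ(t) := √(a(t₀−t)), and suppose (v,p) is a suitable weak solution of the Navier–Stokes system ∂ₜv + v·∇v = −∇p + νΔv, div v = 0 on Q_{a,ρ} := B_{√a·ρ}(x₀) × (t₀−ρ², t₀). Define v̄(x̄,t̄) := θ(t)·v(x₀+θ(t)x̄, t) and p̄(x̄,t̄) := θ(t)²·p(x₀+θ(t)x̄, t), where t := t₀ − ρ² e^{−a t̄}. Then (v̄, p̄) is a suitable weak solution of the transformed system ∂_{t̄}v̄ + v̄·∇v̄ = −∇p̄ + νΔv̄ − (a/2)v̄ − (a/2)x̄·∇v̄, div v̄ = 0, in any bounded sub-domain of Q̄_a := {(x̄,t̄) ∈ ℝ⁴ : t̄ > 0 and |x̄| < e^{a t̄/2}}; in particular, (v̄,p̄) satisfies the generalized energy inequality 2ν∫∫ |∇v̄|² φ dx̄ dt̄ ≤ ∫∫ [ |v̄|²(∂_{t̄}φ + νΔφ) + (|v̄|² + 2p̄) v̄·∇φ + (a/2)|v̄|²φ + (a/2)(x̄·∇φ)|v̄|² ] dx̄ dt̄ for every nonnegative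 φ ∈ C₀^∞(Q̄_a). -/

import Mathlib

open MeasureTheory Set
open scoped ENNReal

noncomputable section

/-- ℝ³ as a Euclidean space. -/
abbrev E3 := EuclideanSpace ℝ (Fin 3)

/-- The `i`-th standard basis vector of ℝ³. -/
def e3 (i : Fin 3) : E3 := EuclideanSpace.single i 1

/-- Partial derivative in the `i`-th coordinate direction. -/
def pd {F : Type*} [NormedAddCommGroup F] [NormedSpace ℝ F]
    (i : Fin 3) (f : E3 → F) (x : E3) : F :=
  fderiv ℝ f x (e3 i)

/-- `(v, p)` is a suitable weak solution of the Navier–Stokes system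
`∂ₜv + v·∇v = −∇p + νΔv`, `div v = 0` on the space-time cylinder `Ω × (t₁, t₂)`. -/
structure IsSuitableWeakSolution (ν : ℝ) (Ω : Set E3) (t₁ t₂ : ℝ)
    (v : E3 → ℝ → E3) (p : E3 → ℝ → ℝ) : Prop where
  meas_v : Measurable fun q : E3 × ℝ => v q.1 q.2
  meas_p : Measurable fun q : E3 × ℝ => p q.1 q.2
  /-- `v ∈ L^∞(t₁,t₂; L²(Ω))` -/
  linfty_l2 : ∃ M : ℝ, ∀ᵐ t ∂(volume.restrict (Ioo t₁ t₂)),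
      (∫⁻ x in Ω, ENNReal.ofReal (‖v x t‖ ^ 2)) ≤ ENNReal.ofReal M
  /-- the associated pressure belongs to `L^{5/4}(Ω × (t₁,t₂))` -/
  pressure_l54 : (∫⁻ t in Ioo t₁ t₂, ∫⁻ x in Ω,
      ENNReal.ofReal (|p x t| ^ ((5 : ℝ) / 4))) < ⊤
  /-- `v(·,t)` is divergence free in the sense of distributions for a.e. `t` -/
  div_free : ∀ᵐ t ∂(volume.restrict (Ioo t₁ t₂)),
      ∀ φ : E3 → ℝ, ContDiff ℝ (⊤ : ℕ∞) φ → HasCompactSupport φ → tsupport φ ⊆ Ω →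
        ∫ x in Ω, ∑ i, v x t i * pd i φ x = 0
  /-- `v ∈ L²(t₁,t₂; W^{1,2}(Ω))` with weak spatial partial derivatives `g i = ∂ᵢv`,
  the momentum equation holds in the sense of distributions, and the pair `(v,p)`
  satisfies the generalized energy inequality. -/
  exists_weak_gradient : ∃ g : Fin 3 → E3 → ℝ → E3,
    (∀ i, Measurable fun q : E3 × ℝ => g i q.1 q.2) ∧
    (∀ i, ∀ᵐ t ∂(volume.restrict (Ioo t₁ t₂)),
      ∀ φ : E3 → ℝ, ContDiff ℝ (⊤ : ℕ∞) φ → HasCompactSupport φ → tsupport φ ⊆ Ω →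
        (∫ x in Ω, pd i φ x • v x t) = -∫ x in Ω, φ x • g i x t) ∧
    ((∫⁻ t in Ioo t₁ t₂, ∫⁻ x in Ω,
        ENNReal.ofReal (∑ i, ‖g i x t‖ ^ 2)) < ⊤) ∧
    (∀ Φ : E3 → ℝ → E3,
      ContDiff ℝ (⊤ : ℕ∞) (fun q : E3 × ℝ => Φ q.1 q.2) →
      HasCompactSupport (fun q : E3 × ℝ => Φ q.1 q.2) →
      tsupport (fun q : E3 × ℝ => Φ q.1 q.2) ⊆ Ω ×ˢ Ioo t₁ t₂ →
      (∫ t in Ioo t₁ t₂, ∫ x in Ω,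
        ((∑ j, v x t j * deriv (fun τ => Φ x τ j) t)
          + (∑ i, ∑ j, v x t i * v x t j * pd i (fun y => Φ y t) x j)
          + p x t * (∑ i, pd i (fun y => Φ y t) x i)
          - ν * ∑ i, ∑ j, g i x t j * pd i (fun y => Φ y t) x j)) = 0) ∧
    (∀ φ : E3 → ℝ → ℝ,
      ContDiff ℝ (⊤ : ℕ∞) (fun q : E3 × ℝ => φ q.1 q.2) →
      HasCompactSupport (fun q : E3 × ℝ => φ q.1 q.2) →
      tsupport (fun q : E3 × ℝ => φ q.1 q.2) ⊆ Ω ×ˢ Ioo t₁ t₂ →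
      (∀ x t, 0 ≤ φ x t) →
      2 * ν * ∫ t in Ioo t₁ t₂, ∫ x in Ω, (∑ i, ‖g i x t‖ ^ 2) * φ x t
        ≤ ∫ t in Ioo t₁ t₂, ∫ x in Ω,
            (‖v x t‖ ^ 2 * (deriv (fun τ => φ x τ) t
                + ν * ∑ i, pd i (pd i (fun y => φ y t)) x)
              + (‖v x t‖ ^ 2 + 2 * p x t)
                  * ∑ i, v x t i * pd i (fun y => φ y t) x))

/-- The expanding space-time region `Q̄_a = {(x̄,t̄) : t̄ > 0, |x̄| < e^{at̄/2}}`. -/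
def Qbar (a : ℝ) : Set (E3 × ℝ) :=
  {q : E3 × ℝ | 0 < q.2 ∧ ‖q.1‖ < Real.exp (a * q.2 / 2)}

/-- `(v̄, p̄)` is a suitable weak solution of the transformed system
`∂_t̄ v̄ + v̄·∇v̄ = −∇p̄ + νΔv̄ − (a/2)v̄ − (a/2)x̄·∇v̄`, `div v̄ = 0`, in every bounded
subdomain of `Q̄_a`: `v̄` lies locally in `L^∞(L²) ∩ L²(W^{1,2})`, is weakly divergence
free, satisfies the transformed momentum equation in the sense of distributions with
pressure `p̄ ∈ L^{5/4}_loc`, and the pair `(v̄,p̄)` satisfies the transformed generalized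
energy inequality for every nonnegative test function supported in `Q̄_a`. -/
structure IsSuitableWeakSolutionTransformed (ν a : ℝ)
    (vb : E3 → ℝ → E3) (pb : E3 → ℝ → ℝ) : Prop where
  meas_v : Measurable fun q : E3 × ℝ => vb q.1 q.2
  meas_p : Measurable fun q : E3 × ℝ => pb q.1 q.2
  /-- locally `v̄ ∈ L^∞(L²)` on bounded subdomains of `Q̄_a` -/
  linfty_l2_loc : ∀ U : Set (E3 × ℝ), IsOpen U → Bornology.IsBounded U →
      closure U ⊆ Qbar a →
      ∃ M : ℝ, ∀ᵐ t ∂(volume : Measure ℝ),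
        (∫⁻ x in {x : E3 | (x, t) ∈ U}, ENNReal.ofReal (‖vb x t‖ ^ 2))
          ≤ ENNReal.ofReal M
  /-- `p̄ ∈ L^{5/4}` on bounded subdomains of `Q̄_a` -/
  pressure_l54_loc : ∀ U : Set (E3 × ℝ), IsOpen U → Bornology.IsBounded U →
      closure U ⊆ Qbar a →
      (∫⁻ q in U, ENNReal.ofReal (|pb q.1 q.2| ^ ((5 : ℝ) / 4))
          ∂(volume : Measure (E3 × ℝ))) < ⊤
  /-- `v̄` is divergence free in the sense of distributions in `Q̄_a` -/
  div_free : ∀ φ : E3 → ℝ → ℝ,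
      ContDiff ℝ (⊤ : ℕ∞) (fun q : E3 × ℝ => φ q.1 q.2) →
      HasCompactSupport (fun q : E3 × ℝ => φ q.1 q.2) →
      tsupport (fun q : E3 × ℝ => φ q.1 q.2) ⊆ Qbar a →
      (∫ t : ℝ, ∫ x : E3, ∑ i, vb x t i * pd i (fun y => φ y t) x) = 0
  /-- `v̄ ∈ L²(W^{1,2})` locally, with weak spatial partial derivatives `g i = ∂ᵢv̄`;
  the transformed momentum equation holds in the sense of distributions and the pair
  `(v̄,p̄)` satisfies the transformed generalized energy inequality. -/
  exists_weak_gradient : ∃ g : Fin 3 → E3 → ℝ → E3,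
    (∀ i, Measurable fun q : E3 × ℝ => g i q.1 q.2) ∧
    -- weak spatial gradient in Q̄_a
    (∀ i, ∀ φ : E3 → ℝ → ℝ,
      ContDiff ℝ (⊤ : ℕ∞) (fun q : E3 × ℝ => φ q.1 q.2) →
      HasCompactSupport (fun q : E3 × ℝ => φ q.1 q.2) →
      tsupport (fun q : E3 × ℝ => φ q.1 q.2) ⊆ Qbar a →
        (∫ t : ℝ, ∫ x : E3, pd i (fun y => φ y t) x • vb x t)
          = -∫ t : ℝ, ∫ x : E3, φ x t • g i x t) ∧
    -- ∇v̄ ∈ L² on bounded subdomains of Q̄_a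
    (∀ U : Set (E3 × ℝ), IsOpen U → Bornology.IsBounded U → closure U ⊆ Qbar a →
      (∫⁻ q in U, ENNReal.ofReal (∑ i, ‖g i q.1 q.2‖ ^ 2)
          ∂(volume : Measure (E3 × ℝ))) < ⊤) ∧
    -- the transformed momentum equation in the sense of distributions
    (∀ Φ : E3 → ℝ → E3,
      ContDiff ℝ (⊤ : ℕ∞) (fun q : E3 × ℝ => Φ q.1 q.2) →
      HasCompactSupport (fun q : E3 × ℝ => Φ q.1 q.2) →
      tsupport (fun q : E3 × ℝ => Φ q.1 q.2) ⊆ Qbar a →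
      (∫ t : ℝ, ∫ x : E3,
        ((∑ j, vb x t j * deriv (fun τ => Φ x τ j) t)
          + (∑ i, ∑ j, vb x t i * vb x t j * pd i (fun y => Φ y t) x j)
          + pb x t * (∑ i, pd i (fun y => Φ y t) x i)
          - ν * ∑ i, ∑ j, g i x t j * pd i (fun y => Φ y t) x j
          - (a / 2) * ∑ j, vb x t j * Φ x t j
          - (a / 2) * ∑ i, ∑ j, x i * g i x t j * Φ x t j)) = 0) ∧
    -- the transformed generalized energy inequality
    (∀ φ : E3 → ℝ → ℝ,
      ContDiff ℝ (⊤ : ℕ∞) (fun q : E3 × ℝ => φ q.1 q.2) →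
      HasCompactSupport (fun q : E3 × ℝ => φ q.1 q.2) →
      tsupport (fun q : E3 × ℝ => φ q.1 q.2) ⊆ Qbar a →
      (∀ x t, 0 ≤ φ x t) →
      2 * ν * ∫ t : ℝ, ∫ x : E3, (∑ i, ‖g i x t‖ ^ 2) * φ x t
        ≤ ∫ t : ℝ, ∫ x : E3,
            (‖vb x t‖ ^ 2 * (deriv (fun τ => φ x τ) t
                + ν * ∑ i, pd i (pd i (fun y => φ y t)) x)
              + (‖vb x t‖ ^ 2 + 2 * pb x t)
                  * (∑ i, vb x t i * pd i (fun y => φ y t) x)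
              + (a / 2) * ‖vb x t‖ ^ 2 * φ x t
              + (a / 2) * (∑ i, x i * pd i (fun y => φ y t) x) * ‖vb x t‖ ^ 2))

/-- The physical time `t₀ - ρ² e^{-as}` corresponding to the similarity time `s`. -/
def physTime (t₀ a ρ s : ℝ) : ℝ := t₀ - ρ ^ 2 * Real.exp (-a * s)

/-- The similarity time `-a⁻¹ log ((t₀ - t) / ρ²)` corresponding to the physical time `t`. -/
def simTime (t₀ a ρ t : ℝ) : ℝ := -a⁻¹ * Real.log ((t₀ - t) / ρ ^ 2)

/-- The length scale `√(a (t₀ - t))`. -/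
def lenScale (t₀ a t : ℝ) : ℝ := Real.sqrt (a * (t₀ - t))

/-- The length scale at similarity time `s`. -/
def simScale (a ρ s : ℝ) : ℝ := Real.sqrt a * ρ * Real.exp (-(a * s / 2))

section Coordinates

variable {t₀ a ρ : ℝ}

lemma simScale_pos (ha : 0 < a) (hρ : 0 < ρ) (s : ℝ) : 0 < simScale a ρ s := by
  unfold simScale; positivity

lemma simScale_sq (ha : 0 < a) (s : ℝ) :
    simScale a ρ s ^ 2 = a * (ρ ^ 2 * Real.exp (-a * s)) := by
  unfold simScale
  rw [mul_pow, mul_pow, Real.sq_sqrt ha.le, ← Real.exp_nat_mul, mul_assoc]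
  congr 3
  push_cast
  ring

lemma lenScale_physTime (ha : 0 < a) (hρ : 0 < ρ) (s : ℝ) :
    lenScale t₀ a (physTime t₀ a ρ s) = simScale a ρ s := by
  unfold lenScale physTime
  rw [sub_sub_cancel, ← simScale_sq ha, Real.sqrt_sq (simScale_pos ha hρ s).le]

lemma simTime_physTime (ha : 0 < a) (hρ : 0 < ρ) (s : ℝ) :
    simTime t₀ a ρ (physTime t₀ a ρ s) = s := by
  unfold simTime physTime
  rw [sub_sub_cancel, mul_div_cancel_left₀ _ (by positivity), Real.log_exp]
  field_simp

lemma physTime_simTime (ha : 0 < a) (hρ : 0 < ρ) {t : ℝ} (ht : t < t₀) :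
    physTime t₀ a ρ (simTime t₀ a ρ t) = t := by
  unfold simTime physTime
  have h : 0 < (t₀ - t) / ρ ^ 2 := div_pos (sub_pos.2 ht) (by positivity)
  have h1 : -a * (-a⁻¹ * Real.log ((t₀ - t) / ρ ^ 2)) = Real.log ((t₀ - t) / ρ ^ 2) := by
    field_simp
  rw [h1, Real.exp_log h]
  field_simp
  ring

lemma physTime_lt (hρ : 0 < ρ) (s : ℝ) : physTime t₀ a ρ s < t₀ := by
  unfold physTime
  have : 0 < ρ ^ 2 * Real.exp (-a * s) := by positivity
  linarith

lemma physTime_mem_Ioo (ha : 0 < a) (hρ : 0 < ρ) {s : ℝ} (hs : 0 < s) :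
    physTime t₀ a ρ s ∈ Ioo (t₀ - ρ ^ 2) t₀ := by
  refine ⟨?_, physTime_lt hρ s⟩
  unfold physTime
  have : Real.exp (-a * s) < 1 := Real.exp_lt_one_iff.2 (by nlinarith)
  have h2 : 0 < ρ ^ 2 := by positivity
  nlinarith

lemma simTime_pos (ha : 0 < a) (hρ : 0 < ρ) {t : ℝ} (ht : t ∈ Ioo (t₀ - ρ ^ 2) t₀) :
    0 < simTime t₀ a ρ t := by
  unfold simTime
  have h2 : 0 < ρ ^ 2 := by positivity
  have : Real.log ((t₀ - t) / ρ ^ 2) < 0 :=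
    Real.log_neg (div_pos (sub_pos.2 ht.2) h2) ((div_lt_one h2).2 (by linarith [ht.1]))
  have h3 : 0 < a⁻¹ := by positivity
  nlinarith

lemma physTime_image (ha : 0 < a) (hρ : 0 < ρ) :
    physTime t₀ a ρ '' Ioi 0 = Ioo (t₀ - ρ ^ 2) t₀ := by
  ext t
  constructor
  · rintro ⟨s, hs, rfl⟩
    exact physTime_mem_Ioo ha hρ hs
  · intro ht
    exact ⟨simTime t₀ a ρ t, simTime_pos ha hρ ht, physTime_simTime ha hρ ht.2⟩

lemma physTime_injective (ha : 0 < a) (hρ : 0 < ρ) : Function.Injective (physTime t₀ a ρ) :=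
  Function.LeftInverse.injective (simTime_physTime ha hρ)

lemma hasDerivAt_physTime (ha : 0 < a) (s : ℝ) :
    HasDerivAt (physTime t₀ a ρ) (simScale a ρ s ^ 2) s := by
  rw [simScale_sq ha]
  unfold physTime
  have h := (((hasDerivAt_id' s).const_mul (-a)).exp.const_mul (ρ ^ 2)).const_sub t₀
  refine h.congr_deriv ?_
  ring

lemma hasDerivAt_simTime (ha : 0 < a) (hρ : 0 < ρ) {t : ℝ} (ht : t < t₀) :
    HasDerivAt (simTime t₀ a ρ) ((lenScale t₀ a t ^ 2)⁻¹) t := by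
  have h0 : 0 < t₀ - t := sub_pos.2 ht
  unfold simTime lenScale
  rw [Real.sq_sqrt (by positivity)]
  have h := (((((hasDerivAt_id' t).const_sub t₀).div_const (ρ ^ 2)).log
    (by positivity)).const_mul (-a⁻¹))
  refine HasDerivAt.congr_deriv h ?_
  field_simp

lemma hasDerivAt_lenScale_inv (ha : 0 < a) {t : ℝ} (ht : t < t₀) :
    HasDerivAt (fun τ => (lenScale t₀ a τ)⁻¹) (a / 2 * (lenScale t₀ a t)⁻¹ ^ 3) t := by
  have h0 : 0 < t₀ - t := sub_pos.2 ht
  have h1 : 0 < a * (t₀ - t) := by positivity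
  have h2 : 0 < Real.sqrt (a * (t₀ - t)) := Real.sqrt_pos.2 h1
  unfold lenScale
  have h := ((((hasDerivAt_id' t).const_sub t₀).const_mul a).sqrt
    (by positivity)).inv (by positivity)
  refine HasDerivAt.congr_deriv h ?_
  field_simp

/-- Null sets of physical times correspond to null sets of similarity times. -/
lemma ae_comp_physTime (ha : 0 < a) (hρ : 0 < ρ) {P : ℝ → Prop}
    (h : ∀ᵐ t ∂(volume.restrict (Ioo (t₀ - ρ ^ 2) t₀)), P t) :
    ∀ᵐ s ∂(volume : Measure ℝ), 0 < s → P (physTime t₀ a ρ s) := by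
  rw [ae_restrict_iff' measurableSet_Ioo, ae_iff] at h
  rw [ae_iff]
  refine measure_mono_null ?_ (addHaar_image_eq_zero_of_differentiableOn_of_addHaar_eq_zero
    (f := simTime t₀ a ρ) volume ?_ h)
  · intro s hs
    simp only [mem_ofPred_eq, Classical.not_imp] at hs
    exact ⟨physTime t₀ a ρ s, by
      simpa only [mem_ofPred_eq, Classical.not_imp] using ⟨physTime_mem_Ioo ha hρ hs.1, hs.2⟩,
      simTime_physTime ha hρ s⟩
  · intro t ht
    simp only [mem_ofPred_eq, Classical.not_imp] at ht
    exact (hasDerivAt_simTime ha hρ ht.1.2).differentiableAt.differentiableWithinAt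

lemma integral_physTime (ha : 0 < a) (hρ : 0 < ρ) {G : Type*} [NormedAddCommGroup G]
    [NormedSpace ℝ G] (f : ℝ → G) :
    ∫ t in Ioo (t₀ - ρ ^ 2) t₀, f t
      = ∫ s in Ioi 0, simScale a ρ s ^ 2 • f (physTime t₀ a ρ s) := by
  rw [← physTime_image ha hρ, integral_image_eq_integral_abs_deriv_smul measurableSet_Ioi
    (fun s _ => (hasDerivAt_physTime ha s).hasDerivWithinAt) (physTime_injective ha hρ).injOn]
  simp only [abs_sq]

lemma lintegral_physTime (ha : 0 < a) (hρ : 0 < ρ) (f : ℝ → ℝ≥0∞) :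
    ∫⁻ t in Ioo (t₀ - ρ ^ 2) t₀, f t
      = ∫⁻ s in Ioi 0, ENNReal.ofReal (simScale a ρ s ^ 2) * f (physTime t₀ a ρ s) := by
  rw [← physTime_image ha hρ, lintegral_image_eq_lintegral_abs_deriv_mul measurableSet_Ioi
    (fun s _ => (hasDerivAt_physTime ha s).hasDerivWithinAt) (physTime_injective ha hρ).injOn]
  simp only [abs_sq]

lemma simScale_antitone (ha : 0 < a) (hρ : 0 < ρ) : Antitone (simScale a ρ) := by
  intro s s' h
  unfold simScale
  gcongr

/-- The spatial change of variables maps the slices of `Qbar a` onto the ball. -/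
lemma add_smul_mem_ball_iff (ha : 0 < a) (hρ : 0 < ρ) (x₀ y : E3) (s : ℝ) :
    x₀ + simScale a ρ s • y ∈ Metric.ball x₀ (Real.sqrt a * ρ) ↔
      ‖y‖ < Real.exp (a * s / 2) := by
  have h := simScale_pos ha hρ s
  rw [mem_ball_iff_norm, add_sub_cancel_left, norm_smul, Real.norm_of_nonneg h.le]
  have h1 : Real.sqrt a * ρ = simScale a ρ s * Real.exp (a * s / 2) := by
    unfold simScale
    rw [mul_assoc, ← Real.exp_add]; simp
  rw [h1, mul_lt_mul_iff_right₀ h]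

end Coordinates

section Space

lemma integral_add_smul {G : Type*} [NormedAddCommGroup G] [NormedSpace ℝ G] (x₀ : E3) {r : ℝ}
    (hr : 0 < r) (f : E3 → G) : ∫ x, f x = r ^ 3 • ∫ y, f (x₀ + r • y) := by
  rw [Measure.integral_comp_smul_of_nonneg volume (fun y => f (x₀ + y)) r (hR := hr.le),
    integral_add_left_eq_self f x₀]
  simp only [finrank_euclideanSpace, Fintype.card_fin, smul_smul]
  rw [mul_inv_cancel₀ (by positivity), one_smul]

lemma lintegral_add_smul (x₀ : E3) {r : ℝ} (hr : 0 < r) {f : E3 → ℝ≥0∞} (hf : Measurable f) :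
    ∫⁻ y, f (x₀ + r • y) = ENNReal.ofReal ((r ^ 3)⁻¹) * ∫⁻ x, f x := by
  have h := lintegral_map (μ := (volume : Measure E3)) (f := fun y => f (x₀ + y))
    (g := fun y => r • y) (hf.comp (measurable_const_add x₀)) (measurable_const_smul r)
  rw [← h, Measure.map_addHaar_smul volume hr.ne', lintegral_smul_measure,
    lintegral_add_left_eq_self f x₀]
  simp only [finrank_euclideanSpace, Fintype.card_fin, smul_eq_mul]
  rw [abs_of_nonneg (by positivity)]

end Space

section Transport

variable {F : Type*} [NormedAddCommGroup F] [NormedSpace ℝ F]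

/-- The function `(x, t) ↦ R⁻ⁿ Φ (R⁻¹ (x - x₀), s)` with `R = lenScale t₀ a t` and
`s = simTime t₀ a ρ t`, extended by zero to `t₀ ≤ t` when `0 < n`. -/
def transport (x₀ : E3) (t₀ a ρ : ℝ) (n : ℕ) (Φ : E3 → ℝ → F) (x : E3) (t : ℝ) : F :=
  (lenScale t₀ a t)⁻¹ ^ n • Φ ((lenScale t₀ a t)⁻¹ • (x - x₀)) (simTime t₀ a ρ t)

variable {x₀ : E3} {t₀ a ρ : ℝ} {n : ℕ} {Φ : E3 → ℝ → F}

lemma lenScale_pos (ha : 0 < a) {t : ℝ} (ht : t < t₀) : 0 < lenScale t₀ a t :=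
  Real.sqrt_pos.2 (mul_pos ha (sub_pos.2 ht))

lemma support_transport_subset (ha : 0 < a) (hρ : 0 < ρ) (hn : n ≠ 0) :
    Function.support (fun q : E3 × ℝ => transport x₀ t₀ a ρ n Φ q.1 q.2) ⊆
      (fun q : E3 × ℝ => (x₀ + simScale a ρ q.2 • q.1, physTime t₀ a ρ q.2)) ''
        tsupport (fun q : E3 × ℝ => Φ q.1 q.2) := by
  rintro ⟨x, t⟩ h
  simp only [Function.mem_support, transport, ne_eq, smul_eq_zero, not_or] at h
  obtain ⟨h1, h2⟩ := h
  have ht : t < t₀ := by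
    by_contra! ht
    apply h1
    rw [lenScale, Real.sqrt_eq_zero_of_nonpos (by nlinarith), inv_zero, zero_pow hn]
  have hR : lenScale t₀ a t = simScale a ρ (simTime t₀ a ρ t) := by
    rw [← lenScale_physTime (t₀ := t₀) ha hρ, physTime_simTime ha hρ ht]
  refine ⟨((lenScale t₀ a t)⁻¹ • (x - x₀), simTime t₀ a ρ t), subset_tsupport _ h2, ?_⟩
  simp only [← hR, physTime_simTime ha hρ ht]
  rw [smul_inv_smul₀ (lenScale_pos ha ht).ne', add_sub_cancel]

lemma continuous_simCoords :
    Continuous (fun q : E3 × ℝ => (x₀ + simScale a ρ q.2 • q.1, physTime t₀ a ρ q.2)) := by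
  unfold simScale physTime
  fun_prop

lemma tsupport_transport_subset_image (ha : 0 < a) (hρ : 0 < ρ) (hn : n ≠ 0)
    (hc : HasCompactSupport (fun q : E3 × ℝ => Φ q.1 q.2)) :
    tsupport (fun q : E3 × ℝ => transport x₀ t₀ a ρ n Φ q.1 q.2) ⊆
      (fun q : E3 × ℝ => (x₀ + simScale a ρ q.2 • q.1, physTime t₀ a ρ q.2)) ''
        tsupport (fun q : E3 × ℝ => Φ q.1 q.2) :=
  closure_minimal (support_transport_subset ha hρ hn)
    (hc.isCompact.image continuous_simCoords).isClosed

lemma hasCompactSupport_transport (ha : 0 < a) (hρ : 0 < ρ) (hn : n ≠ 0)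
    (hc : HasCompactSupport (fun q : E3 × ℝ => Φ q.1 q.2)) :
    HasCompactSupport (fun q : E3 × ℝ => transport x₀ t₀ a ρ n Φ q.1 q.2) :=
  HasCompactSupport.of_support_subset_isCompact (hc.isCompact.image continuous_simCoords)
    (support_transport_subset ha hρ hn)

lemma tsupport_transport_subset (ha : 0 < a) (hρ : 0 < ρ) (hn : n ≠ 0)
    (hc : HasCompactSupport (fun q : E3 × ℝ => Φ q.1 q.2))
    (hs : tsupport (fun q : E3 × ℝ => Φ q.1 q.2) ⊆ Qbar a) :
    tsupport (fun q : E3 × ℝ => transport x₀ t₀ a ρ n Φ q.1 q.2) ⊆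
      Metric.ball x₀ (Real.sqrt a * ρ) ×ˢ Ioo (t₀ - ρ ^ 2) t₀ := by
  refine (tsupport_transport_subset_image ha hρ hn hc).trans ?_
  rintro _ ⟨⟨y, s⟩, hq, rfl⟩
  have h := hs hq
  exact ⟨(add_smul_mem_ball_iff ha hρ x₀ y s).2 h.2, physTime_mem_Ioo ha hρ h.1⟩

lemma contDiff_transport (ha : 0 < a) (hρ : 0 < ρ) (hn : n ≠ 0)
    (hΦ : ContDiff ℝ (⊤ : ℕ∞) (fun q : E3 × ℝ => Φ q.1 q.2))
    (hc : HasCompactSupport (fun q : E3 × ℝ => Φ q.1 q.2))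
    (hs : tsupport (fun q : E3 × ℝ => Φ q.1 q.2) ⊆ Qbar a) :
    ContDiff ℝ (⊤ : ℕ∞) (fun q : E3 × ℝ => transport x₀ t₀ a ρ n Φ q.1 q.2) := by
  rw [contDiff_iff_contDiffAt]
  intro q
  by_cases hq : q.2 < t₀
  · have h0 : a * (t₀ - q.2) ≠ 0 := (mul_pos ha (sub_pos.2 hq)).ne'
    have h1 : ContDiffAt ℝ (⊤ : ℕ∞) (fun q : E3 × ℝ => (lenScale t₀ a q.2)⁻¹) q := by
      refine ContDiffAt.inv ?_ (lenScale_pos ha hq).ne'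
      exact ContDiffAt.sqrt (by fun_prop) h0
    have h2 : ContDiffAt ℝ (⊤ : ℕ∞) (fun q : E3 × ℝ => simTime t₀ a ρ q.2) q := by
      refine contDiffAt_const.mul (ContDiffAt.log (by fun_prop) ?_)
      exact (div_pos (sub_pos.2 hq) (by positivity)).ne'
    have h3 : ContDiffAt ℝ (⊤ : ℕ∞)
        (fun q : E3 × ℝ => ((lenScale t₀ a q.2)⁻¹ • (q.1 - x₀), simTime t₀ a ρ q.2)) q :=
      (h1.smul (by fun_prop)).prodMk h2
    exact (h1.pow n).smul (hΦ.contDiffAt.comp q h3)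
  · have hq' : q ∉ tsupport (fun q : E3 × ℝ => transport x₀ t₀ a ρ n Φ q.1 q.2) := fun h =>
      hq (tsupport_transport_subset ha hρ hn hc hs h).2.2
    exact contDiffAt_const.congr_of_eventuallyEq (notMem_tsupport_iff_eventuallyEq.1 hq')

lemma pd_smul_comp_affine (i : Fin 3) {f : E3 → F} (hf : Differentiable ℝ f) (c c' : ℝ)
    (x₀ x : E3) :
    pd i (fun x => c' • f (c • (x - x₀))) x = (c' * c) • pd i f (c • (x - x₀)) := by
  have h1 : HasFDerivAt (fun x : E3 => c • (x - x₀)) (c • ContinuousLinearMap.id ℝ E3) x :=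
    ((hasFDerivAt_id x).sub_const x₀).const_smul c
  have h2 := ((hf (c • (x - x₀))).hasFDerivAt.comp x h1).const_smul c'
  unfold pd
  erw [h2.fderiv]
  simp [smul_smul]

lemma transport_physTime (ha : 0 < a) (hρ : 0 < ρ) (x : E3) (s : ℝ) :
    transport x₀ t₀ a ρ n Φ x (physTime t₀ a ρ s) =
      (simScale a ρ s)⁻¹ ^ n • Φ ((simScale a ρ s)⁻¹ • (x - x₀)) s := by
  rw [transport, lenScale_physTime ha hρ, simTime_physTime ha hρ]

lemma differentiable_slice (hΦ : ContDiff ℝ (⊤ : ℕ∞) (fun q : E3 × ℝ => Φ q.1 q.2)) (s : ℝ) :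
    Differentiable ℝ (fun y => Φ y s) :=
  (hΦ.comp (contDiff_id.prodMk contDiff_const)).differentiable (by simp)

lemma contDiff_slice (hΦ : ContDiff ℝ (⊤ : ℕ∞) (fun q : E3 × ℝ => Φ q.1 q.2)) (s : ℝ) :
    ContDiff ℝ (⊤ : ℕ∞) (fun y => Φ y s) :=
  hΦ.comp (contDiff_id.prodMk contDiff_const)

lemma contDiff_pd {f : E3 → F} (hf : ContDiff ℝ (⊤ : ℕ∞) f) (i : Fin 3) :
    ContDiff ℝ (⊤ : ℕ∞) (pd i f) :=
  (hf.fderiv_right (m := (⊤ : ℕ∞)) (by simp)).clm_apply contDiff_const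

lemma pd_transport_physTime (ha : 0 < a) (hρ : 0 < ρ)
    (hΦ : ContDiff ℝ (⊤ : ℕ∞) (fun q : E3 × ℝ => Φ q.1 q.2)) (i : Fin 3) (x : E3) (s : ℝ) :
    pd i (fun x => transport x₀ t₀ a ρ n Φ x (physTime t₀ a ρ s)) x =
      (simScale a ρ s)⁻¹ ^ (n + 1) •
        pd i (fun y => Φ y s) ((simScale a ρ s)⁻¹ • (x - x₀)) := by
  simp only [transport_physTime ha hρ]
  rw [pd_smul_comp_affine i (differentiable_slice hΦ s), pow_succ]

lemma pd_pd_transport_physTime (ha : 0 < a) (hρ : 0 < ρ)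
    (hΦ : ContDiff ℝ (⊤ : ℕ∞) (fun q : E3 × ℝ => Φ q.1 q.2)) (i : Fin 3) (x : E3) (s : ℝ) :
    pd i (pd i (fun x => transport x₀ t₀ a ρ n Φ x (physTime t₀ a ρ s))) x =
      (simScale a ρ s)⁻¹ ^ (n + 2) •
        pd i (pd i (fun y => Φ y s)) ((simScale a ρ s)⁻¹ • (x - x₀)) := by
  have h : pd i (fun x => transport x₀ t₀ a ρ n Φ x (physTime t₀ a ρ s)) = fun x =>
      (simScale a ρ s)⁻¹ ^ (n + 1) •
        pd i (fun y => Φ y s) ((simScale a ρ s)⁻¹ • (x - x₀)) :=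
    funext fun x => pd_transport_physTime ha hρ hΦ i x s
  rw [h, pd_smul_comp_affine i ((contDiff_pd (contDiff_slice hΦ s) i).differentiable (by simp)),
    pow_succ _ (n + 1)]

lemma fderiv_apply_eq_sum_pd (f : E3 → F) (y z : E3) :
    fderiv ℝ f y z = ∑ i, z i • pd i f y := by
  have hz : z = ∑ i, z i • e3 i := by
    ext j
    simp [e3, Finset.sum_apply, Pi.single_apply]
  conv_lhs => rw [hz]
  simp [pd]

lemma hasDerivAt_transport (ha : 0 < a) (hρ : 0 < ρ)
    (hΦ : ContDiff ℝ (⊤ : ℕ∞) (fun q : E3 × ℝ => Φ q.1 q.2)) (y : E3) (s : ℝ) :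
    HasDerivAt (fun τ => transport x₀ t₀ a ρ n Φ (x₀ + simScale a ρ s • y) τ)
      ((simScale a ρ s)⁻¹ ^ (n + 2) • (deriv (fun σ => Φ y σ) s
        + (a / 2) • ∑ i, y i • pd i (fun z => Φ z s) y + (n * (a / 2)) • Φ y s))
      (physTime t₀ a ρ s) := by
  have hr := simScale_pos ha hρ s
  have ht := physTime_lt (t₀ := t₀) (a := a) hρ s
  set Ψ : E3 × ℝ → F := fun q => Φ q.1 q.2 with hΨ
  have hd : HasFDerivAt Ψ (fderiv ℝ Ψ (y, s)) (y, s) :=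
    (hΦ.differentiable (by simp) (y, s)).hasFDerivAt
  have hY : ∀ z, fderiv ℝ Ψ (y, s) (z, 0) = fderiv ℝ (fun z => Φ z s) y z := by
    intro z
    have h := HasFDerivAt.comp (f := fun z : E3 => (z, s)) y hd
      ((hasFDerivAt_id y).prodMk (hasFDerivAt_const s y))
    have h' : HasFDerivAt (fun z => Φ z s) _ y := h
    rw [h'.fderiv]
    simp
  have hS : fderiv ℝ Ψ (y, s) (0, 1) = deriv (fun σ => Φ y σ) s := by
    have h := hd.comp_hasDerivAt s ((hasDerivAt_const s y).prodMk (hasDerivAt_id s))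
    have h' : HasDerivAt (fun σ => Φ y σ) _ s := h
    rw [h'.deriv]
  have h1 := hasDerivAt_lenScale_inv (t₀ := t₀) ha ht
  have h2 := hasDerivAt_simTime (t₀ := t₀) ha hρ ht
  rw [lenScale_physTime ha hρ] at h1 h2
  have h3 := (h1.smul_const (x₀ + simScale a ρ s • y - x₀)).prodMk h2
  have hpt : ((lenScale t₀ a (physTime t₀ a ρ s))⁻¹ • (x₀ + simScale a ρ s • y - x₀),
      simTime t₀ a ρ (physTime t₀ a ρ s)) = (y, s) := by
    rw [lenScale_physTime ha hρ, simTime_physTime ha hρ, add_sub_cancel_left,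
      inv_smul_smul₀ hr.ne']
  have h4 := HasFDerivAt.comp_hasDerivAt (physTime t₀ a ρ s) (hpt ▸ hd) h3
  have h5 := (h1.pow n).smul h4
  refine HasDerivAt.congr_deriv h5 ?_
  have hsplit : ∀ (z : E3) (c : ℝ), fderiv ℝ Ψ (y, s) (z, c) =
      ∑ i, z i • pd i (fun z => Φ z s) y + c • deriv (fun σ => Φ y σ) s := by
    intro z c
    have : (z, c) = (z, (0 : ℝ)) + c • ((0 : E3), (1 : ℝ)) := by simp
    rw [this, map_add, map_smul, hS, hY, fderiv_apply_eq_sum_pd]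
  simp only [Function.comp_apply, lenScale_physTime ha hρ, simTime_physTime ha hρ, Pi.pow_apply,
    add_sub_cancel_left, inv_smul_smul₀ hr.ne', hsplit]
  have hn : (n : ℝ) * (simScale a ρ s)⁻¹ ^ (n - 1) * (a / 2 * (simScale a ρ s)⁻¹ ^ 3) =
      (simScale a ρ s)⁻¹ ^ (n + 2) * (n * (a / 2)) := by
    rcases n with _ | n
    · simp
    · simp only [Nat.add_sub_cancel]
      ring
  have hy : ∀ i, ((a / 2 * (simScale a ρ s)⁻¹ ^ 3) • simScale a ρ s • y) i =
      (simScale a ρ s)⁻¹ ^ 2 * (a / 2) * y i := by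
    intro i
    simp only [PiLp.smul_apply, smul_eq_mul]
    field_simp
  simp only [hn, hy]
  simp only [mul_smul, ← Finset.smul_sum, smul_add, pow_add, hΨ]
  congr 1
  rw [add_comm, inv_pow _ 2]

end Transport

section Vanishing

variable {F : Type*} [NormedAddCommGroup F] {Φ : E3 → ℝ → F} {x : E3} {t : ℝ}

lemma eventually_slice_eq_zero (h : (x, t) ∉ tsupport (fun q : E3 × ℝ => Φ q.1 q.2)) :
    (fun y => Φ y t) =ᶠ[nhds x] 0 := by
  have h1 := notMem_tsupport_iff_eventuallyEq.1 h
  have h2 : Filter.Tendsto (fun y : E3 => (y, t)) (nhds x) (nhds (x, t)) :=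
    (Continuous.prodMk_left t).tendsto x
  exact h2.eventually h1

lemma eq_zero_of_notMem_tsupport (h : (x, t) ∉ tsupport (fun q : E3 × ℝ => Φ q.1 q.2)) :
    Φ x t = 0 :=
  (eventually_slice_eq_zero h).self_of_nhds

lemma tsupport_slice_subset :
    tsupport (fun y => Φ y t) ⊆ {y | (y, t) ∈ tsupport (fun q : E3 × ℝ => Φ q.1 q.2)} := by
  refine closure_minimal (fun y hy => subset_tsupport _ hy) ?_
  exact (isClosed_tsupport _).preimage (Continuous.prodMk_left t)

lemma hasCompactSupport_slice (hc : HasCompactSupport (fun q : E3 × ℝ => Φ q.1 q.2)) :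
    HasCompactSupport (fun y => Φ y t) :=
  HasCompactSupport.of_support_subset_isCompact (hc.isCompact.image continuous_fst)
    fun y hy => ⟨(y, t), subset_tsupport _ hy, rfl⟩

variable [NormedSpace ℝ F]

lemma eventually_pd_eq_zero (h : (x, t) ∉ tsupport (fun q : E3 × ℝ => Φ q.1 q.2)) (i : Fin 3) :
    pd i (fun y => Φ y t) =ᶠ[nhds x] 0 := by
  filter_upwards [(eventually_slice_eq_zero h).fderiv (𝕜 := ℝ)] with y hy
  simp [pd, hy]

lemma pd_eq_zero_of_notMem_tsupport (h : (x, t) ∉ tsupport (fun q : E3 × ℝ => Φ q.1 q.2))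
    (i : Fin 3) : pd i (fun y => Φ y t) x = 0 :=
  (eventually_pd_eq_zero h i).self_of_nhds

lemma pd_pd_eq_zero_of_notMem_tsupport (h : (x, t) ∉ tsupport (fun q : E3 × ℝ => Φ q.1 q.2))
    (i : Fin 3) : pd i (pd i (fun y => Φ y t)) x = 0 := by
  have h1 := (eventually_pd_eq_zero h i).fderiv_eq (𝕜 := ℝ)
  unfold pd at h1 ⊢
  rw [h1]
  simp

lemma deriv_eq_zero_of_notMem_tsupport (h : (x, t) ∉ tsupport (fun q : E3 × ℝ => Φ q.1 q.2)) :
    deriv (fun τ => Φ x τ) t = 0 := by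
  have h1 := notMem_tsupport_iff_eventuallyEq.1 h
  have h2 : Filter.Tendsto (fun τ : ℝ => (x, τ)) (nhds t) (nhds (x, t)) :=
    (Continuous.prodMk_right x).tendsto t
  have h3 : (fun τ => Φ x τ) =ᶠ[nhds t] 0 := h2.eventually h1
  rw [h3.deriv_eq]
  simp

lemma deriv_comp_coord {Φ : E3 → ℝ → E3}
    (hΦ : ContDiff ℝ (⊤ : ℕ∞) (fun q : E3 × ℝ => Φ q.1 q.2)) (x : E3) (t : ℝ) (j : Fin 3) :
    deriv (fun τ => Φ x τ j) t = deriv (fun τ => Φ x τ) t j := by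
  have h : DifferentiableAt ℝ (fun τ => Φ x τ) t :=
    (hΦ.comp (contDiff_const.prodMk contDiff_id)).differentiable (by simp) t
  exact ((EuclideanSpace.proj (𝕜 := ℝ) j).hasFDerivAt.comp_hasDerivAt t h.hasDerivAt).deriv

lemma pd_comp_coord {Φ : E3 → E3} (hΦ : Differentiable ℝ Φ) (x : E3) (i j : Fin 3) :
    pd i (fun y => Φ y j) x = pd i Φ x j := by
  have h' : HasFDerivAt (fun y => Φ y j) _ x :=
    (EuclideanSpace.proj (𝕜 := ℝ) j).hasFDerivAt.comp x (hΦ x).hasFDerivAt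
  unfold pd
  rw [h'.fderiv]
  simp

end Vanishing

section Slices

variable {x₀ : E3} {r : ℝ} {Ω : Set E3}

lemma tsupport_comp_affine_subset {ψ : E3 → ℝ} (hr : 0 < r) (hc : HasCompactSupport ψ) :
    tsupport (fun x => ψ (r⁻¹ • (x - x₀))) ⊆ (fun y => x₀ + r • y) '' tsupport ψ := by
  refine closure_minimal (fun x hx => ⟨r⁻¹ • (x - x₀), subset_tsupport _ hx, ?_⟩)
    (hc.isCompact.image (by fun_prop)).isClosed
  simp only [smul_inv_smul₀ hr.ne', add_sub_cancel]

lemma hasCompactSupport_comp_affine {ψ : E3 → ℝ} (hr : 0 < r) (hc : HasCompactSupport ψ) :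
    HasCompactSupport (fun x => ψ (r⁻¹ • (x - x₀))) :=
  (hc.isCompact.image (by fun_prop : Continuous fun y : E3 => x₀ + r • y)).of_isClosed_subset
    (isClosed_tsupport _) (tsupport_comp_affine_subset hr hc)

lemma contDiff_comp_affine {ψ : E3 → ℝ} (hψ : ContDiff ℝ (⊤ : ℕ∞) ψ) :
    ContDiff ℝ (⊤ : ℕ∞) (fun x => ψ (r⁻¹ • (x - x₀))) :=
  hψ.comp (by fun_prop)

lemma pd_comp_affine {ψ : E3 → ℝ} (hψ : ContDiff ℝ (⊤ : ℕ∞) ψ) (hr : 0 < r) (i : Fin 3) (y : E3) :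
    pd i (fun x => ψ (r⁻¹ • (x - x₀))) (x₀ + r • y) = r⁻¹ * pd i ψ y := by
  have h := pd_smul_comp_affine i (hψ.differentiable (by simp)) r⁻¹ 1 x₀ (x₀ + r • y)
  simpa [inv_smul_smul₀ hr.ne'] using h

lemma tsupport_pd_subset {F : Type*} [NormedAddCommGroup F] [NormedSpace ℝ F] (f : E3 → F)
    (i : Fin 3) : tsupport (pd i f) ⊆ tsupport f := by
  refine closure_minimal (fun x hx => ?_) (isClosed_tsupport _)
  refine support_fderiv_subset ℝ (f := f) fun h => hx ?_
  simp [pd, h]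

/-- Rescaling of a weak gradient. -/
lemma integral_pd_smul_rescale (hr : 0 < r) {f g : E3 → E3} {i : Fin 3}
    (h : ∀ φ : E3 → ℝ, ContDiff ℝ (⊤ : ℕ∞) φ → HasCompactSupport φ → tsupport φ ⊆ Ω →
      (∫ x in Ω, pd i φ x • f x) = -∫ x in Ω, φ x • g x)
    {ψ : E3 → ℝ} (hψ : ContDiff ℝ (⊤ : ℕ∞) ψ) (hc : HasCompactSupport ψ)
    (hs : tsupport ψ ⊆ (fun y => x₀ + r • y) ⁻¹' Ω) :
    (∫ y, pd i ψ y • r • f (x₀ + r • y)) = -∫ y, ψ y • r ^ 2 • g (x₀ + r • y) := by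
  have hsub : tsupport (fun x => ψ (r⁻¹ • (x - x₀))) ⊆ Ω :=
    (tsupport_comp_affine_subset hr hc).trans (image_subset_iff.2 hs)
  have h1 := h _ (contDiff_comp_affine (r := r) (x₀ := x₀) hψ)
    (hasCompactSupport_comp_affine hr hc) hsub
  rw [setIntegral_eq_integral_of_forall_compl_eq_zero, setIntegral_eq_integral_of_forall_compl_eq_zero,
    integral_add_smul x₀ hr, integral_add_smul x₀ hr (fun x => ψ (r⁻¹ • (x - x₀)) • g x)] at h1
  · simp only [pd_comp_affine hψ hr, add_sub_cancel_left, inv_smul_smul₀ hr.ne'] at h1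
    rw [← smul_neg] at h1
    have h2 := smul_right_injective E3 (pow_pos hr 3).ne' h1
    have h3 : ∀ y, pd i ψ y • r • f (x₀ + r • y) =
        r ^ 2 • ((r⁻¹ * pd i ψ y) • f (x₀ + r • y)) := fun y => by
      simp only [smul_smul]; congr 1; field_simp
    have h4 : ∀ y, ψ y • r ^ 2 • g (x₀ + r • y) = r ^ 2 • (ψ y • g (x₀ + r • y)) :=
      fun y => smul_comm _ _ _
    simp only [h3, h4, integral_smul, h2, smul_neg]
  · intro x hx
    rw [image_eq_zero_of_notMem_tsupport fun h' => hx (hsub h'), zero_smul]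
  · intro x hx
    rw [image_eq_zero_of_notMem_tsupport
      fun h' => hx (hsub (tsupport_pd_subset _ i h')), zero_smul]

/-- Rescaling of the weak divergence condition. -/
lemma integral_div_rescale (hr : 0 < r) {f : E3 → E3}
    (h : ∀ φ : E3 → ℝ, ContDiff ℝ (⊤ : ℕ∞) φ → HasCompactSupport φ → tsupport φ ⊆ Ω →
      ∫ x in Ω, ∑ i, f x i * pd i φ x = 0)
    {ψ : E3 → ℝ} (hψ : ContDiff ℝ (⊤ : ℕ∞) ψ) (hc : HasCompactSupport ψ)
    (hs : tsupport ψ ⊆ (fun y => x₀ + r • y) ⁻¹' Ω) :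
    ∫ y, ∑ i, (r • f (x₀ + r • y)) i * pd i ψ y = 0 := by
  have hsub : tsupport (fun x => ψ (r⁻¹ • (x - x₀))) ⊆ Ω :=
    (tsupport_comp_affine_subset hr hc).trans (image_subset_iff.2 hs)
  have h1 := h _ (contDiff_comp_affine (r := r) (x₀ := x₀) hψ)
    (hasCompactSupport_comp_affine hr hc) hsub
  rw [setIntegral_eq_integral_of_forall_compl_eq_zero, integral_add_smul x₀ hr] at h1
  · simp only [pd_comp_affine hψ hr] at h1
    have h2 : ∫ y, ∑ i, f (x₀ + r • y) i * (r⁻¹ * pd i ψ y) = 0 :=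
      (smul_eq_zero.1 h1).resolve_left (pow_pos hr 3).ne'
    have h3 : ∀ y, ∑ i, (r • f (x₀ + r • y)) i * pd i ψ y =
        r ^ 2 * ∑ i, f (x₀ + r • y) i * (r⁻¹ * pd i ψ y) := fun y => by
      rw [Finset.mul_sum]
      refine Finset.sum_congr rfl fun i _ => ?_
      simp only [PiLp.smul_apply, smul_eq_mul]
      field_simp
    simp only [h3, integral_const_mul, h2, mul_zero]
  · intro x hx
    refine Finset.sum_eq_zero fun i _ => ?_
    rw [image_eq_zero_of_notMem_tsupport
      fun h' => hx (hsub (tsupport_pd_subset _ i h')), mul_zero]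

lemma integrableOn_of_lintegral_sq_lt_top {f : E3 → E3} (hf : Measurable f)
    (hΩ : volume Ω < ⊤) (h : ∫⁻ x in Ω, ENNReal.ofReal (‖f x‖ ^ 2) < ⊤) :
    IntegrableOn f Ω := by
  have : IsFiniteMeasure (volume.restrict Ω) := ⟨by simpa using hΩ⟩
  have h1 : Integrable (fun x => ‖f x‖ ^ 2) (volume.restrict Ω) := by
    refine ⟨by fun_prop, ?_⟩
    rw [hasFiniteIntegral_iff_ofReal (Filter.Eventually.of_forall fun x => by positivity)]
    exact h
  refine Integrable.mono' ((integrable_const (1 : ℝ)).add h1) (by fun_prop)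
    (Filter.Eventually.of_forall fun x => ?_)
  simp only [Pi.add_apply]
  nlinarith [sq_nonneg (‖f x‖ - 1), sq_nonneg (‖f x‖)]

lemma integrable_smul_rescale (hr : 0 < r) (hΩ : MeasurableSet Ω) {f : E3 → E3}
    (hf : IntegrableOn f Ω) (c : ℝ) {ψ : E3 → ℝ} (hψ : Continuous ψ) (hc : HasCompactSupport ψ)
    (hs : tsupport ψ ⊆ (fun y => x₀ + r • y) ⁻¹' Ω) :
    Integrable (fun y => ψ y • c • f (x₀ + r • y)) := by
  have h1 : Integrable (fun y => Ω.indicator f (x₀ + r • y)) :=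
    (((integrable_indicator_iff hΩ).2 hf).comp_add_left x₀).comp_smul hr.ne'
  obtain ⟨C, hC⟩ := hc.exists_bound_of_continuous hψ
  have h2 := (h1.smul c).bdd_smul (φ := ψ) C hψ.aestronglyMeasurable
    (Filter.Eventually.of_forall hC)
  refine h2.congr (Filter.Eventually.of_forall fun y => ?_)
  simp only [Pi.smul_apply, Pi.smul_apply']
  by_cases hy : y ∈ tsupport ψ
  · rw [indicator_of_mem (show x₀ + r • y ∈ Ω from hs hy)]
  · simp only [image_eq_zero_of_notMem_tsupport hy, zero_smul]

end Slices

section ChangeOfVariables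

variable {x₀ : E3} {t₀ a ρ : ℝ}

lemma integral_simCoords (ha : 0 < a) (hρ : 0 < ρ) {A B : E3 → ℝ → ℝ}
    (hA : ∀ x t, x ∉ Metric.ball x₀ (Real.sqrt a * ρ) → A x t = 0)
    (hB : ∀ y s, s ≤ 0 → B y s = 0)
    (hAB : ∀ᵐ s, 0 < s →
      ∫ y, B y s = ∫ y, simScale a ρ s ^ 5 * A (x₀ + simScale a ρ s • y) (physTime t₀ a ρ s)) :
    ∫ t in Ioo (t₀ - ρ ^ 2) t₀, ∫ x in Metric.ball x₀ (Real.sqrt a * ρ), A x t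
      = ∫ s, ∫ y, B y s := by
  rw [← setIntegral_eq_integral_of_forall_compl_eq_zero (s := Ioi (0 : ℝ))
    (f := fun s => ∫ y, B y s) (fun s hs => by simp [hB _ s (not_lt.1 hs)]),
    integral_physTime ha hρ]
  refine setIntegral_congr_ae measurableSet_Ioi ?_
  filter_upwards [hAB] with s hs hs0
  rw [hs hs0, setIntegral_eq_integral_of_forall_compl_eq_zero fun x hx => hA x _ hx,
    integral_add_smul x₀ (simScale_pos ha hρ s), integral_const_mul]
  simp only [smul_eq_mul]
  ring

lemma lintegral_slice_le (ha : 0 < a) (hρ : 0 < ρ) {U : Set (E3 × ℝ)}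
    (hU : U ⊆ Qbar a) (s : ℝ) {f : E3 → ℝ≥0∞} (hf : Measurable f) :
    ∫⁻ y in {y | (y, s) ∈ U}, f (x₀ + simScale a ρ s • y) ≤
      ENNReal.ofReal ((simScale a ρ s ^ 3)⁻¹) *
        ∫⁻ x in Metric.ball x₀ (Real.sqrt a * ρ), f x := by
  rw [← lintegral_indicator Metric.isOpen_ball.measurableSet,
    ← lintegral_add_smul x₀ (simScale_pos ha hρ s)
      (hf.indicator Metric.isOpen_ball.measurableSet)]
  refine le_trans (setLIntegral_mono ?_ ?_) (setLIntegral_le_lintegral {y | (y, s) ∈ U} _)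
  · exact (hf.indicator Metric.isOpen_ball.measurableSet).comp (by fun_prop)
  intro y hy
  rw [indicator_of_mem ((add_smul_mem_ball_iff ha hρ x₀ y s).2 (hU hy).2)]

lemma exists_time_bound {U : Set (E3 × ℝ)} (hb : Bornology.IsBounded U) :
    ∃ K : ℝ, ∀ q ∈ U, q.2 ≤ K := by
  obtain ⟨K, hK⟩ := hb.exists_norm_le
  exact ⟨K, fun q hq => (le_abs_self _).trans ((norm_snd_le q).trans (hK q hq))⟩

lemma lintegral_simCoords_lt_top (ha : 0 < a) (hρ : 0 < ρ) {U : Set (E3 × ℝ)}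
    (hUo : IsOpen U) (hb : Bornology.IsBounded U) (hU : U ⊆ Qbar a)
    {f : E3 × ℝ → ℝ≥0∞} (hf : Measurable f)
    (hfi : ∫⁻ t in Ioo (t₀ - ρ ^ 2) t₀, ∫⁻ x in Metric.ball x₀ (Real.sqrt a * ρ), f (x, t) < ⊤)
    {H : E3 × ℝ → ℝ≥0∞} {C : ℝ≥0∞} (hC : C ≠ ⊤)
    (hH : ∀ q ∈ U, H q ≤ C * f (x₀ + simScale a ρ q.2 • q.1, physTime t₀ a ρ q.2)) :
    ∫⁻ q in U, H q < ⊤ := by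
  obtain ⟨K, hK⟩ := exists_time_bound hb
  set G : E3 × ℝ → ℝ≥0∞ :=
    fun q => f (x₀ + simScale a ρ q.2 • q.1, physTime t₀ a ρ q.2) with hG
  have hGm : Measurable G := hf.comp continuous_simCoords.measurable
  have hle : ∫⁻ q in U, G q ≤ ENNReal.ofReal ((simScale a ρ K ^ 5)⁻¹) *
      ∫⁻ t in Ioo (t₀ - ρ ^ 2) t₀, ∫⁻ x in Metric.ball x₀ (Real.sqrt a * ρ), f (x, t) := by
    rw [← lintegral_indicator hUo.measurableSet, Measure.volume_eq_prod,
      lintegral_prod_symm' _ (hGm.indicator hUo.measurableSet), lintegral_physTime ha hρ,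
      ← lintegral_const_mul' _ _ ENNReal.ofReal_ne_top, ← lintegral_indicator measurableSet_Ioi]
    refine lintegral_mono fun s => ?_
    have hslice : ∫⁻ y, U.indicator G (y, s) = ∫⁻ y in {y | (y, s) ∈ U}, G (y, s) := by
      rw [← lintegral_indicator]
      · rfl
      · exact (hUo.preimage (Continuous.prodMk_left s)).measurableSet
    rw [hslice]
    by_cases hs : ∃ y, (y, s) ∈ U
    · obtain ⟨y, hy⟩ := hs
      have h0 : 0 < s := (hU hy).1
      have h1 : s ≤ K := hK _ hy
      rw [indicator_of_mem (show s ∈ Ioi 0 from h0)]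
      refine (lintegral_slice_le ha hρ hU s
        (f := fun x => f (x, physTime t₀ a ρ s)) (by fun_prop)).trans ?_
      rw [← mul_assoc, ← ENNReal.ofReal_mul (by have := simScale_pos ha hρ K; positivity)]
      gcongr
      have hrK := simScale_pos ha hρ K
      have hrs := simScale_pos ha hρ s
      have hmono := simScale_antitone ha hρ h1
      calc (simScale a ρ s ^ 3)⁻¹ = (simScale a ρ s ^ 5)⁻¹ * simScale a ρ s ^ 2 := by
            field_simp
        _ ≤ _ := by gcongr
    · have : {y | (y, s) ∈ U} = ∅ := by
        ext y
        simpa using fun h => hs ⟨y, h⟩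
      simp [this]
  calc ∫⁻ q in U, H q ≤ ∫⁻ q in U, C * G q := setLIntegral_mono' hUo.measurableSet hH
    _ = C * ∫⁻ q in U, G q := lintegral_const_mul' _ _ hC
    _ < ⊤ := ENNReal.mul_lt_top hC.lt_top
        (hle.trans_lt (ENNReal.mul_lt_top ENNReal.ofReal_lt_top hfi))

/-- Integration by parts for the drift term `x · ∇w`, for a field with weak gradient `h`. -/
lemma integrable_drift_and_integral_eq_zero {w : E3 → E3} {h : Fin 3 → E3 → E3} {Φ : E3 → E3}
    (hΦ : ContDiff ℝ (⊤ : ℕ∞) Φ) (hc : HasCompactSupport Φ)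
    (hparts : ∀ i, ∀ ψ : E3 → ℝ, ContDiff ℝ (⊤ : ℕ∞) ψ → HasCompactSupport ψ →
      tsupport ψ ⊆ tsupport Φ → (∫ y, pd i ψ y • w y) = -∫ y, ψ y • h i y)
    (hw : ∀ ψ : E3 → ℝ, Continuous ψ → HasCompactSupport ψ → tsupport ψ ⊆ tsupport Φ →
      Integrable fun y => ψ y • w y)
    (hh : ∀ i, ∀ ψ : E3 → ℝ, Continuous ψ → HasCompactSupport ψ → tsupport ψ ⊆ tsupport Φ →
      Integrable fun y => ψ y • h i y) :
    Integrable (fun y => ∑ i, ∑ j,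
        (w y j * (Φ y j + y i * pd i Φ y j) + y i * h i y j * Φ y j)) ∧
      ∫ y, ∑ i, ∑ j, (w y j * (Φ y j + y i * pd i Φ y j) + y i * h i y j * Φ y j) = 0 := by
  have key : ∀ i j, Integrable (fun y =>
        w y j * (Φ y j + y i * pd i Φ y j) + y i * h i y j * Φ y j) ∧
      ∫ y, (w y j * (Φ y j + y i * pd i Φ y j) + y i * h i y j * Φ y j) = 0 := by
    intro i j
    set ψ : E3 → ℝ := fun y => y i * Φ y j with hψ
    have hj : ContDiff ℝ (⊤ : ℕ∞) fun y => Φ y j :=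
      (EuclideanSpace.proj (𝕜 := ℝ) j).contDiff.comp hΦ
    have hi : ContDiff ℝ (⊤ : ℕ∞) fun y : E3 => y i :=
      (EuclideanSpace.proj (𝕜 := ℝ) i).contDiff
    have hψs : ContDiff ℝ (⊤ : ℕ∞) ψ := hi.mul hj
    have hsub : tsupport ψ ⊆ tsupport Φ := by
      refine closure_mono fun y hy hy' => hy ?_
      simp [hψ, hy']
    have hψc : HasCompactSupport ψ := hc.of_isClosed_subset (isClosed_tsupport _) hsub
    have hpsub : tsupport (pd i ψ) ⊆ tsupport Φ := (tsupport_pd_subset ψ i).trans hsub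
    have hpc : HasCompactSupport (pd i ψ) := hc.of_isClosed_subset (isClosed_tsupport _) hpsub
    have hpd : ∀ y, pd i ψ y = Φ y j + y i * pd i Φ y j := by
      intro y
      have h1 : HasFDerivAt (fun y : E3 => y i) (EuclideanSpace.proj (𝕜 := ℝ) i) y :=
        (EuclideanSpace.proj (𝕜 := ℝ) i).hasFDerivAt
      have h2 := (hj.differentiable (by simp) y).hasFDerivAt
      have h3 := h1.mul h2
      have h4 : fderiv ℝ (fun y => Φ y j) y (e3 i) = pd i Φ y j :=
        pd_comp_coord (hΦ.differentiable (by simp)) y i j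
      have h5 : HasFDerivAt ψ _ y := h3
      rw [pd, h5.fderiv]
      simp only [add_apply, smul_apply, h4]
      simp [e3]
      ring
    have hI1 := hw _ (contDiff_pd hψs i).continuous hpc hpsub
    have hI2 := hh i _ hψs.continuous hψc hsub
    have hE := hparts i ψ hψs hψc hsub
    have hsum : ∀ y, (EuclideanSpace.proj (𝕜 := ℝ) j) (pd i ψ y • w y + ψ y • h i y) =
        w y j * (Φ y j + y i * pd i Φ y j) + y i * h i y j * Φ y j := by
      intro y
      rw [hpd]
      simp only [hψ, map_add, map_smul, smul_eq_mul, PiLp.proj_apply]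
      ring
    have hI : Integrable fun y => pd i ψ y • w y + ψ y • h i y := hI1.add hI2
    constructor
    · refine ((EuclideanSpace.proj (𝕜 := ℝ) j).integrable_comp hI).congr
        (Filter.Eventually.of_forall hsum)
    · rw [← integral_congr_ae (Filter.Eventually.of_forall hsum),
        ContinuousLinearMap.integral_comp_comm _ hI, integral_add hI1 hI2, hE]
      simp
  refine ⟨integrable_finsetSum _ fun i _ => integrable_finsetSum _ fun j _ => (key i j).1, ?_⟩
  rw [integral_finsetSum _ fun i _ => integrable_finsetSum _ fun j _ => (key i j).1]
  refine Finset.sum_eq_zero fun i _ => ?_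
  rw [integral_finsetSum _ fun j _ => (key i j).1]
  exact Finset.sum_eq_zero fun j _ => (key i j).2

end ChangeOfVariables

section Solution

variable {x₀ : E3} {t₀ a ρ ν : ℝ} {v : E3 → ℝ → E3} {p : E3 → ℝ → ℝ}

lemma ae_simTime_integrableOn (ha : 0 < a) (hρ : 0 < ρ) {f : E3 → ℝ → E3}
    (hf : Measurable fun q : E3 × ℝ => f q.1 q.2)
    (h : ∀ᵐ t ∂(volume.restrict (Ioo (t₀ - ρ ^ 2) t₀)),
      ∫⁻ x in Metric.ball x₀ (Real.sqrt a * ρ), ENNReal.ofReal (‖f x t‖ ^ 2) < ⊤) :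
    ∀ᵐ s, 0 < s → IntegrableOn (fun x => f x (physTime t₀ a ρ s))
      (Metric.ball x₀ (Real.sqrt a * ρ)) := by
  filter_upwards [ae_comp_physTime ha hρ h] with s hs hs0
  exact integrableOn_of_lintegral_sq_lt_top (hf.comp measurable_prodMk_right)
    measure_ball_lt_top (hs hs0)

lemma tsupport_slice_subset_preimage_ball (ha : 0 < a) (hρ : 0 < ρ)
    {F : Type*} [NormedAddCommGroup F] {Φ : E3 → ℝ → F}
    (hs : tsupport (fun q : E3 × ℝ => Φ q.1 q.2) ⊆ Qbar a) (s : ℝ) :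
    tsupport (fun y => Φ y s) ⊆
      (fun y => x₀ + simScale a ρ s • y) ⁻¹' Metric.ball x₀ (Real.sqrt a * ρ) :=
  fun y hy => (add_smul_mem_ball_iff ha hρ x₀ y s).2 (hs (tsupport_slice_subset hy)).2

lemma notMem_tsupport_of_nonpos {F : Type*} [NormedAddCommGroup F] {Φ : E3 → ℝ → F}
    (hs : tsupport (fun q : E3 × ℝ => Φ q.1 q.2) ⊆ Qbar a) (y : E3) {s : ℝ} (h : s ≤ 0) :
    (y, s) ∉ tsupport (fun q : E3 × ℝ => Φ q.1 q.2) :=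
  fun h' => h.not_gt (hs h').1

/-- The transformed momentum integrand differs from the original one by the drift integrand. -/
lemma momentum_integrand_rescale (ha : 0 < a) (hρ : 0 < ρ)
    {Φ : E3 → ℝ → E3} (hΦ : ContDiff ℝ (⊤ : ℕ∞) (fun q : E3 × ℝ => Φ q.1 q.2))
    (hΨ : ContDiff ℝ (⊤ : ℕ∞) (fun q : E3 × ℝ => transport x₀ t₀ a ρ 2 Φ q.1 q.2))
    (V : E3) (P : ℝ) (g : Fin 3 → E3) (y : E3) (s : ℝ) :
    ((∑ j, (simScale a ρ s • V) j * deriv (fun τ => Φ y τ j) s)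
      + (∑ i, ∑ j, (simScale a ρ s • V) i * (simScale a ρ s • V) j *
          pd i (fun y => Φ y s) y j)
      + (simScale a ρ s ^ 2 * P) * (∑ i, pd i (fun y => Φ y s) y i)
      - ν * ∑ i, ∑ j, (simScale a ρ s ^ 2 • g i) j * pd i (fun y => Φ y s) y j
      - (a / 2) * ∑ j, (simScale a ρ s • V) j * Φ y s j
      - (a / 2) * ∑ i, ∑ j, y i * (simScale a ρ s ^ 2 • g i) j * Φ y s j) =
    simScale a ρ s ^ 5 *
      ((∑ j, V j * deriv (fun τ => transport x₀ t₀ a ρ 2 Φ (x₀ + simScale a ρ s • y) τ j)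
          (physTime t₀ a ρ s))
        + (∑ i, ∑ j, V i * V j * pd i
            (fun y => transport x₀ t₀ a ρ 2 Φ y (physTime t₀ a ρ s)) (x₀ + simScale a ρ s • y) j)
        + P * (∑ i, pd i
            (fun y => transport x₀ t₀ a ρ 2 Φ y (physTime t₀ a ρ s)) (x₀ + simScale a ρ s • y) i)
        - ν * ∑ i, ∑ j, g i j * pd i
            (fun y => transport x₀ t₀ a ρ 2 Φ y (physTime t₀ a ρ s)) (x₀ + simScale a ρ s • y) j)
      - (a / 2) * ∑ i, ∑ j, ((simScale a ρ s • V) j *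
          (Φ y s j + y i * pd i (fun y => Φ y s) y j)
          + y i * (simScale a ρ s ^ 2 • g i) j * Φ y s j) := by
  have hr := (simScale_pos ha hρ s).ne'
  simp only [deriv_comp_coord hΦ, deriv_comp_coord hΨ, (hasDerivAt_transport ha hρ hΦ y s).deriv,
    pd_transport_physTime ha hρ hΦ, add_sub_cancel_left, inv_smul_smul₀ hr, PiLp.smul_apply,
    PiLp.add_apply, smul_eq_mul, Fin.sum_univ_three]
  generalize simScale a ρ s = r at hr ⊢
  simp only [inv_pow, Nat.reduceAdd, Nat.cast_ofNat]
  field_simp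
  ring

/-- The energy inequality integrand is invariant under the change of variables. -/
lemma energy_integrand_rescale (ha : 0 < a) (hρ : 0 < ρ)
    {φ : E3 → ℝ → ℝ} (hφ : ContDiff ℝ (⊤ : ℕ∞) (fun q : E3 × ℝ => φ q.1 q.2))
    (V : E3) (P : ℝ) (y : E3) (s : ℝ) :
    (‖simScale a ρ s • V‖ ^ 2 * (deriv (fun τ => φ y τ) s
          + ν * ∑ i, pd i (pd i (fun y => φ y s)) y)
        + (‖simScale a ρ s • V‖ ^ 2 + 2 * (simScale a ρ s ^ 2 * P))
            * (∑ i, (simScale a ρ s • V) i * pd i (fun y => φ y s) y)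
        + (a / 2) * ‖simScale a ρ s • V‖ ^ 2 * φ y s
        + (a / 2) * (∑ i, y i * pd i (fun y => φ y s) y) * ‖simScale a ρ s • V‖ ^ 2) =
    simScale a ρ s ^ 5 *
      (‖V‖ ^ 2 * (deriv (fun τ => transport x₀ t₀ a ρ 1 φ (x₀ + simScale a ρ s • y) τ)
            (physTime t₀ a ρ s)
          + ν * ∑ i, pd i (pd i (fun y => transport x₀ t₀ a ρ 1 φ y (physTime t₀ a ρ s)))
              (x₀ + simScale a ρ s • y))
        + (‖V‖ ^ 2 + 2 * P) * ∑ i, V i * pd i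
            (fun y => transport x₀ t₀ a ρ 1 φ y (physTime t₀ a ρ s))
              (x₀ + simScale a ρ s • y)) := by
  have hr := simScale_pos ha hρ s
  simp only [(hasDerivAt_transport ha hρ hφ y s).deriv, norm_smul, Real.norm_of_nonneg hr.le,
    pd_transport_physTime ha hρ hφ, pd_pd_transport_physTime ha hρ hφ, add_sub_cancel_left,
    inv_smul_smul₀ hr.ne', PiLp.smul_apply, smul_eq_mul, Fin.sum_univ_three]
  replace hr := hr.ne'
  generalize simScale a ρ s = r at hr ⊢
  simp only [inv_pow, Nat.reduceAdd, Nat.cast_one]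
  field_simp
  ring

lemma transport_nonneg {φ : E3 → ℝ → ℝ} {n : ℕ} (h : ∀ x t, 0 ≤ φ x t) (x : E3) (t : ℝ) :
    0 ≤ transport x₀ t₀ a ρ n φ x t :=
  mul_nonneg (pow_nonneg (inv_nonneg.2 (Real.sqrt_nonneg _)) _) (h _ _)

lemma integral_sub_of_integral_eq_zero {f d : E3 → ℝ} (hd : Integrable d)
    (h0 : ∫ y, d y = 0) : ∫ y, (f y - d y) = ∫ y, f y := by
  by_cases hf : Integrable f
  · rw [integral_sub hf hd, h0, sub_zero]
  · rw [integral_undef hf, integral_undef]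
    intro h
    exact hf ((h.add hd).congr (.of_forall fun y => sub_add_cancel (f y) (d y)))

end Solution

/-- **Transformation to self-similar variables.** If `(v,p)` is a suitable weak solution
of the Navier–Stokes system on `Q_{a,ρ} = B_{√a·ρ}(x₀) × (t₀−ρ², t₀)` and
`v̄(x̄,t̄) = θ(t)·v(x₀+θ(t)x̄, t)`, `p̄(x̄,t̄) = θ(t)²·p(x₀+θ(t)x̄, t)` with
`θ(t) = √(a(t₀−t))` and `t = t₀ − ρ²e^{−at̄}`, then `(v̄,p̄)` is a suitable weak
solution of the transformed system
`∂_t̄ v̄ + v̄·∇v̄ = −∇p̄ + νΔv̄ − (a/2)v̄ − (a/2)x̄·∇v̄`, `div v̄ = 0`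
in every bounded subdomain of `Q̄_a = {(x̄,t̄) : t̄ > 0, |x̄| < e^{at̄/2}}`; in
particular it satisfies the transformed generalized energy inequality. -/
theorem stmt_15 (ν : ℝ) (hν : 0 < ν) (x₀ : E3) (t₀ a ρ : ℝ) (ha : 0 < a) (hρ : 0 < ρ)
    (θ : ℝ → ℝ) (hθ : ∀ t, θ t = Real.sqrt (a * (t₀ - t)))
    (v : E3 → ℝ → E3) (p : E3 → ℝ → ℝ)
    (hsol : IsSuitableWeakSolution ν (Metric.ball x₀ (Real.sqrt a * ρ))
      (t₀ - ρ ^ 2) t₀ v p)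
    (vb : E3 → ℝ → E3) (pb : E3 → ℝ → ℝ)
    (hvb : ∀ xb tb, vb xb tb =
      θ (t₀ - ρ ^ 2 * Real.exp (-a * tb)) •
        v (x₀ + θ (t₀ - ρ ^ 2 * Real.exp (-a * tb)) • xb)
          (t₀ - ρ ^ 2 * Real.exp (-a * tb)))
    (hpb : ∀ xb tb, pb xb tb =
      (θ (t₀ - ρ ^ 2 * Real.exp (-a * tb))) ^ 2 *
        p (x₀ + θ (t₀ - ρ ^ 2 * Real.exp (-a * tb)) • xb)
          (t₀ - ρ ^ 2 * Real.exp (-a * tb))) :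
    IsSuitableWeakSolutionTransformed ν a vb pb := by
  have hr : ∀ s, θ (t₀ - ρ ^ 2 * Real.exp (-a * s)) = simScale a ρ s := fun s => by
    rw [hθ]
    exact lenScale_physTime ha hρ s
  obtain ⟨hvm, hpm, ⟨M, hM⟩, hp54, hdiv, g, hgm, hgw, hg2, hmom, hen⟩ := hsol
  obtain rfl : vb = fun y s => simScale a ρ s • v (x₀ + simScale a ρ s • y)
      (physTime t₀ a ρ s) := by
    funext y s
    rw [hvb, hr]
    rfl
  obtain rfl : pb = fun y s => simScale a ρ s ^ 2 * p (x₀ + simScale a ρ s • y)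
      (physTime t₀ a ρ s) := by
    funext y s
    rw [hpb, hr]
    rfl
  clear hvb hpb hr hθ
  have hcm := (continuous_simCoords (x₀ := x₀) (t₀ := t₀) (a := a) (ρ := ρ)).measurable
  have hrm : Measurable fun q : E3 × ℝ => simScale a ρ q.2 := by
    unfold simScale
    fun_prop
  have hrpos := simScale_pos ha hρ
  have hball : MeasurableSet (Metric.ball x₀ (Real.sqrt a * ρ)) :=
    Metric.isOpen_ball.measurableSet
  have hr0 : ∀ s, 0 < s → simScale a ρ s ≤ simScale a ρ 0 := fun s hs =>
    simScale_antitone ha hρ hs.le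
  have hgm2 : Measurable fun q : E3 × ℝ => ENNReal.ofReal (∑ i, ‖g i q.1 q.2‖ ^ 2) :=
    (Finset.measurable_sum _ fun i _ => (hgm i).norm.pow_const 2).ennreal_ofReal
  have hvI := ae_simTime_integrableOn ha hρ hvm
    (hM.mono fun t ht => lt_of_le_of_lt ht ENNReal.ofReal_lt_top)
  have hgI : ∀ i, ∀ᵐ s, 0 < s → IntegrableOn (fun x => g i x (physTime t₀ a ρ s))
      (Metric.ball x₀ (Real.sqrt a * ρ)) := by
    intro i
    refine ae_simTime_integrableOn ha hρ (hgm i) ?_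
    refine (ae_lt_top ?_ hg2.ne).mono fun t ht => lt_of_le_of_lt ?_ ht
    · exact Measurable.lintegral_prod_left' (f := fun q : E3 × ℝ =>
        ENNReal.ofReal (∑ i, ‖g i q.1 q.2‖ ^ 2)) hgm2
    · refine lintegral_mono fun x => ENNReal.ofReal_le_ofReal ?_
      exact Finset.single_le_sum (f := fun i => ‖g i x t‖ ^ 2) (fun _ _ => sq_nonneg _)
        (Finset.mem_univ i)
  refine ⟨hrm.smul (hvm.comp hcm), (hrm.pow_const 2).mul (hpm.comp hcm), ?_, ?_, ?_,
    fun i y s => simScale a ρ s ^ 2 • g i (x₀ + simScale a ρ s • y) (physTime t₀ a ρ s),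
    fun i => (hrm.pow_const 2).smul ((hgm i).comp hcm), ?_, ?_, ?_, ?_⟩
  · intro U hUo hb hU
    replace hU := subset_closure.trans hU
    obtain ⟨K, hK⟩ := exists_time_bound hb
    refine ⟨(simScale a ρ K)⁻¹ * M, ?_⟩
    filter_upwards [ae_comp_physTime ha hρ hM] with s hs
    by_cases hne : ∃ y, (y, s) ∈ U
    · obtain ⟨y, hy⟩ := hne
      have hsK := simScale_antitone ha hρ (hK _ hy)
      have h1 := lintegral_slice_le (x₀ := x₀) ha hρ hU s
        (f := fun x => ENNReal.ofReal (‖v x (physTime t₀ a ρ s)‖ ^ 2))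
        ((hvm.comp measurable_prodMk_right).norm.pow_const 2).ennreal_ofReal
      have h2 := hs (hU hy).1
      simp only [norm_smul, mul_pow, Real.norm_of_nonneg (hrpos s).le]
      simp_rw [ENNReal.ofReal_mul (sq_nonneg (simScale a ρ s))]
      rw [lintegral_const_mul' _ _ ENNReal.ofReal_ne_top,
        ENNReal.ofReal_mul (inv_nonneg.2 (hrpos K).le)]
      calc _ ≤ ENNReal.ofReal (simScale a ρ s ^ 2) *
            (ENNReal.ofReal ((simScale a ρ s ^ 3)⁻¹) * ENNReal.ofReal M) := by
              gcongr
              exact h1.trans (by gcongr)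
        _ = ENNReal.ofReal ((simScale a ρ s)⁻¹) * ENNReal.ofReal M := by
              rw [← mul_assoc, ← ENNReal.ofReal_mul (sq_nonneg _)]
              congr 2
              have := (hrpos s).ne'
              field_simp
        _ ≤ _ := by
              have := hrpos K
              gcongr
    · have : {y | (y, s) ∈ U} = ∅ := by
        ext y
        simpa using fun h => hne ⟨y, h⟩
      simp [this]
  · intro U hUo hb hU
    replace hU := subset_closure.trans hU
    refine lintegral_simCoords_lt_top ha hρ hUo hb hU
      (f := fun q => ENNReal.ofReal (|p q.1 q.2| ^ ((5 : ℝ) / 4)))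
      ((continuous_abs.measurable.comp hpm).pow_const _).ennreal_ofReal hp54
      (C := ENNReal.ofReal ((simScale a ρ 0 ^ 2) ^ ((5 : ℝ) / 4))) ENNReal.ofReal_ne_top ?_
    intro q hq
    rw [← ENNReal.ofReal_mul (by positivity), abs_mul, abs_sq,
      Real.mul_rpow (sq_nonneg _) (abs_nonneg _)]
    have := hr0 q.2 (hU hq).1
    have := (hrpos q.2).le
    gcongr
  · intro φ hφ hc hs
    refine integral_eq_zero_of_ae ?_
    filter_upwards [ae_comp_physTime ha hρ hdiv] with s h
    rcases le_or_gt s 0 with h0 | h0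
    · have : ∀ y i, pd i (fun y => φ y s) y = 0 := fun y i =>
        pd_eq_zero_of_notMem_tsupport (notMem_tsupport_of_nonpos hs y h0) i
      simp [this]
    · exact integral_div_rescale (hrpos s) (h h0) (contDiff_slice hφ s)
        (hasCompactSupport_slice hc) (tsupport_slice_subset_preimage_ball ha hρ hs s)
  · intro i φ hφ hc hs
    rw [← integral_neg]
    refine integral_congr_ae ?_
    filter_upwards [ae_comp_physTime ha hρ (hgw i)] with s h
    rcases le_or_gt s 0 with h0 | h0
    · have h1 : ∀ y i, pd i (fun y => φ y s) y = 0 := fun y i =>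
        pd_eq_zero_of_notMem_tsupport (notMem_tsupport_of_nonpos hs y h0) i
      have h2 : ∀ y, φ y s = 0 := fun y =>
        eq_zero_of_notMem_tsupport (notMem_tsupport_of_nonpos hs y h0)
      simp only [h1, zero_smul]
      simp [h2]
    · exact integral_pd_smul_rescale (hrpos s) (h h0) (contDiff_slice hφ s)
        (hasCompactSupport_slice hc) (tsupport_slice_subset_preimage_ball ha hρ hs s)
  · intro U hUo hb hU
    replace hU := subset_closure.trans hU
    refine lintegral_simCoords_lt_top ha hρ hUo hb hU
      (f := fun q => ENNReal.ofReal (∑ i, ‖g i q.1 q.2‖ ^ 2)) hgm2 hg2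
      (C := ENNReal.ofReal ((simScale a ρ 0 ^ 2) ^ 2)) ENNReal.ofReal_ne_top ?_
    intro q hq
    rw [← ENNReal.ofReal_mul (by positivity)]
    simp only [norm_smul, mul_pow, ← Finset.mul_sum]
    rw [Real.norm_of_nonneg (sq_nonneg _)]
    have := hr0 q.2 (hU hq).1
    have := (hrpos q.2).le
    gcongr
  · intro Φ hΦ hc hs
    have hΨ := contDiff_transport (x₀ := x₀) (t₀ := t₀) ha hρ two_ne_zero hΦ hc hs
    have hsub := tsupport_transport_subset (x₀ := x₀) (t₀ := t₀) ha hρ two_ne_zero hc hs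
    have h := hmom _ hΨ (hasCompactSupport_transport ha hρ two_ne_zero hc) hsub
    rw [← h]
    symm
    refine integral_simCoords ha hρ ?_ ?_ ?_
    · intro x t hx
      have hxt : (x, t) ∉ tsupport fun q : E3 × ℝ => transport x₀ t₀ a ρ 2 Φ q.1 q.2 :=
        fun h' => hx (hsub h').1
      simp [deriv_comp_coord hΨ, deriv_eq_zero_of_notMem_tsupport hxt,
        pd_eq_zero_of_notMem_tsupport hxt]
    · intro y s h0
      have hys := notMem_tsupport_of_nonpos hs y h0
      simp [deriv_comp_coord hΦ, deriv_eq_zero_of_notMem_tsupport hys,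
        pd_eq_zero_of_notMem_tsupport hys, eq_zero_of_notMem_tsupport hys]
    · filter_upwards [hvI, ae_all_iff.2 hgI,
        ae_all_iff.2 fun i => ae_comp_physTime ha hρ (hgw i)] with s hv hg hw h0
      have hsl := tsupport_slice_subset_preimage_ball (x₀ := x₀) ha hρ hs s
      obtain ⟨hD, hD0⟩ := integrable_drift_and_integral_eq_zero
        (w := fun y => simScale a ρ s • v (x₀ + simScale a ρ s • y) (physTime t₀ a ρ s))
        (h := fun i y => simScale a ρ s ^ 2 • g i (x₀ + simScale a ρ s • y) (physTime t₀ a ρ s))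
        (contDiff_slice hΦ s) (hasCompactSupport_slice hc)
        (fun i ψ h1 h2 h3 => integral_pd_smul_rescale (hrpos s) (hw i h0) h1 h2 (h3.trans hsl))
        (fun ψ h1 h2 h3 => integrable_smul_rescale (hrpos s) hball (hv h0) _ h1 h2
          (h3.trans hsl))
        (fun i ψ h1 h2 h3 => integrable_smul_rescale (hrpos s) hball (hg i h0) _ h1 h2
          (h3.trans hsl))
      simp only [momentum_integrand_rescale (x₀ := x₀) (t₀ := t₀) ha hρ hΦ hΨ]
      exact integral_sub_of_integral_eq_zero (hD.const_mul (a / 2))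
        (by rw [integral_const_mul, hD0, mul_zero])
  · intro φ hφ hc hs hφ0
    have hΨ := contDiff_transport (x₀ := x₀) (t₀ := t₀) ha hρ one_ne_zero hφ hc hs
    have hsub := tsupport_transport_subset (x₀ := x₀) (t₀ := t₀) ha hρ one_ne_zero hc hs
    have h := hen _ hΨ (hasCompactSupport_transport ha hρ one_ne_zero hc) hsub
      (transport_nonneg hφ0)
    have hxt : ∀ x t, x ∉ Metric.ball x₀ (Real.sqrt a * ρ) →
        (x, t) ∉ tsupport fun q : E3 × ℝ => transport x₀ t₀ a ρ 1 φ q.1 q.2 :=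
      fun x t hx h' => hx (hsub h').1
    refine le_of_eq_of_le ?_ (h.trans_eq ?_)
    · congr 1
      symm
      refine integral_simCoords ha hρ ?_ ?_ (Filter.Eventually.of_forall fun s h0 => ?_)
      · intro x t hx
        simp [eq_zero_of_notMem_tsupport (hxt x t hx)]
      · intro y s h0
        simp [eq_zero_of_notMem_tsupport (notMem_tsupport_of_nonpos hs y h0)]
      · refine integral_congr_ae (Filter.Eventually.of_forall fun y => ?_)
        have := (hrpos s).ne'
        simp only [transport_physTime ha hρ, add_sub_cancel_left, inv_smul_smul₀ this, norm_smul,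
          mul_pow, ← Finset.mul_sum, smul_eq_mul, Real.norm_of_nonneg (sq_nonneg (simScale a ρ s))]
        field_simp
    · refine integral_simCoords ha hρ ?_ ?_ (Filter.Eventually.of_forall fun s h0 => ?_)
      · intro x t hx
        simp [deriv_eq_zero_of_notMem_tsupport (hxt x t hx),
          pd_eq_zero_of_notMem_tsupport (hxt x t hx),
          pd_pd_eq_zero_of_notMem_tsupport (hxt x t hx)]
      · intro y s h0
        have hys := notMem_tsupport_of_nonpos hs y h0
        simp [deriv_eq_zero_of_notMem_tsupport hys, eq_zero_of_notMem_tsupport hys,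
          pd_eq_zero_of_notMem_tsupport hys, pd_pd_eq_zero_of_notMem_tsupport hys]
      · exact integral_congr_ae (Filter.Eventually.of_forall fun y =>
          energy_integrand_rescale ha hρ hφ _ _ y s)
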